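/- For every n ≥ 0, the number of equivalence classes of classical Dyck excursions of length 2n + 2 under the relation 'two excursions of the same length are equivalent if and only if the occurrences of the pattern duu are at exactly the same positions' equals m_n, the number of Dyck meanders with catastrophes of length n. -/

import Mathlib

/-- Validity of a path with catastrophes over the jump set `J`, starting from
altitude `h`: each step is either a jump `s ∈ J` keeping the altitude
nonnegative, or a catastrophe `s = -h` from an altitude `h > 0` with `-h ∉ J`
(landing at altitude `0`). -/
def CatValidFrom (J : Finset ℤ) : ℤ → List ℤ → Prop
  | _, [] => True
  | h, s :: r =>
    ((s ∈ J ∧ 0 ≤ h + s) ∨ (s = -h ∧ 0 < h ∧ -h ∉ J)) ∧ CatValidFrom J (h + s) r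

/-- The jump set of Dyck paths. For this jump set a catastrophe is a jump
`-h` from an altitude `h ≥ 2` to altitude `0`. -/
def dyckJ : Finset ℤ := {-1, 1}

/-- The number `m n` of Dyck meanders with catastrophes of length `n`. -/
noncomputable def mCount (n : ℕ) : ℕ :=
  Nat.card {l : List ℤ // l.length = n ∧ CatValidFrom dyckJ 0 l}

/-- `l` is a classical Dyck excursion: steps `±1`, never going below
altitude `0`, ending at altitude `0`. -/
def IsDyckExc (l : List ℤ) : Prop :=
  (∀ s ∈ l, s = 1 ∨ s = -1) ∧ (∀ i : ℕ, 0 ≤ (l.take i).sum) ∧ l.sum = 0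

/-- The set of positions at which the pattern `duu` occurs in `l`: position
`i` is an occurrence iff steps `i, i+1, i+2` (0-indexed) are `-1, +1, +1`. -/
def duuSet (l : List ℤ) : Set ℕ := {i | ((l.drop i).take 3) = [-1, 1, 1]}

/-! ### Dyck meanders with catastrophes -/

/-- The meanders with catastrophes of length `n` starting at altitude `h`. -/
def catMeanders : ℕ → ℕ → Finset (List ℤ)
  | 0, _ => {[]}
  | n + 1, 0 => (catMeanders n 1).image (List.cons 1)
  | n + 1, 1 => (catMeanders n 2).image (List.cons 1) ∪ (catMeanders n 0).image (List.cons (-1))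
  | n + 1, h + 2 => (catMeanders n (h + 3)).image (List.cons 1) ∪
      (catMeanders n (h + 1)).image (List.cons (-1)) ∪
      (catMeanders n 0).image (List.cons (-((h : ℤ) + 2)))

theorem mem_catMeanders {n h : ℕ} {l : List ℤ} :
    l ∈ catMeanders n h ↔ l.length = n ∧ CatValidFrom dyckJ h l := by
  induction n generalizing h l with
  | zero => cases l <;> simp [catMeanders, CatValidFrom]
  | succ n ih =>
    cases l with
    | nil => rcases h with _ | _ | h <;> simp [catMeanders]
    | cons s r =>
      rcases h with _ | _ | h
      · simp only [catMeanders, Finset.mem_image, List.cons.injEq, ih, CatValidFrom, dyckJ,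
          Finset.mem_insert, Finset.mem_singleton, List.length_cons]
        constructor
        · rintro ⟨a, ⟨ha, hv⟩, rfl, rfl⟩
          exact ⟨by omega, Or.inl ⟨by simp, by simp⟩, by simpa using hv⟩
        · rintro ⟨hl, hs, hv⟩
          have : s = 1 := by simp at hs; omega
          subst this
          exact ⟨r, ⟨by omega, by simpa using hv⟩, rfl, rfl⟩
      · simp only [catMeanders, Finset.mem_union, Finset.mem_image, List.cons.injEq, ih,
          CatValidFrom, dyckJ, Finset.mem_insert, Finset.mem_singleton, List.length_cons]
        constructor
        · rintro (⟨a, ⟨ha, hv⟩, rfl, rfl⟩ | ⟨a, ⟨ha, hv⟩, rfl, rfl⟩)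
          · exact ⟨by omega, Or.inl ⟨by simp, by simp⟩, by simpa using hv⟩
          · exact ⟨by omega, Or.inl ⟨by simp, by simp⟩, by simpa using hv⟩
        · rintro ⟨hl, hs, hv⟩
          have : s = 1 ∨ s = -1 := by push_cast at hs; omega
          rcases this with rfl | rfl
          · exact Or.inl ⟨r, ⟨by omega, by simpa using hv⟩, rfl, rfl⟩
          · exact Or.inr ⟨r, ⟨by omega, by simpa using hv⟩, rfl, rfl⟩
      · simp only [catMeanders, Finset.mem_union, Finset.mem_image, List.cons.injEq, ih,
          CatValidFrom, dyckJ, Finset.mem_insert, Finset.mem_singleton, List.length_cons]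
        have e1 : ((h + 1 + 1 : ℕ) : ℤ) + 1 = ((h + 3 : ℕ) : ℤ) := by push_cast; ring
        have e2 : ((h + 1 + 1 : ℕ) : ℤ) + -1 = ((h + 1 : ℕ) : ℤ) := by push_cast; ring
        have e3 : ((h + 1 + 1 : ℕ) : ℤ) + -((h : ℤ) + 2) = ((0 : ℕ) : ℤ) := by push_cast; ring
        constructor
        · rintro ((⟨a, ⟨ha, hv⟩, rfl, rfl⟩ | ⟨a, ⟨ha, hv⟩, rfl, rfl⟩) | ⟨a, ⟨ha, hv⟩, rfl, rfl⟩)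
          · exact ⟨by omega, by grind, by rwa [e1]⟩
          · exact ⟨by omega, by grind, by rwa [e2]⟩
          · exact ⟨by omega, by grind, by rwa [e3]⟩
        · rintro ⟨hl, hs, hv⟩
          have : s = 1 ∨ s = -1 ∨ s = -((h : ℤ) + 2) := by push_cast at hs; omega
          rcases this with rfl | rfl | rfl
          · exact Or.inl (Or.inl ⟨r, ⟨by omega, by rwa [e1] at hv⟩, rfl, rfl⟩)
          · exact Or.inl (Or.inr ⟨r, ⟨by omega, by rwa [e2] at hv⟩, rfl, rfl⟩)
          · exact Or.inr ⟨r, ⟨by omega, by rwa [e3] at hv⟩, rfl, rfl⟩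

theorem mCount_eq_card_catMeanders (n : ℕ) : mCount n = (catMeanders n 0).card :=
  Nat.subtype_card _ fun l => by simp [mem_catMeanders]

/-- The transfer operator of meanders with catastrophes. -/
def catStep (v : ℕ → ℕ) : ℕ → ℕ
  | 0 => v 1
  | 1 => v 2 + v 0
  | h + 2 => v (h + 3) + v (h + 1) + v 0

theorem disjoint_image_cons {α : Type*} [DecidableEq α] {a b : α} (hab : a ≠ b)
    (s t : Finset (List α)) : Disjoint (s.image (List.cons a)) (t.image (List.cons b)) := by
  rw [Finset.disjoint_left]
  simp only [Finset.mem_image]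
  rintro _ ⟨x, _, rfl⟩ ⟨y, _, h⟩
  exact hab (List.cons.inj h).1.symm

theorem card_catMeanders_succ (n h : ℕ) :
    (catMeanders (n + 1) h).card = catStep (fun k => (catMeanders n k).card) h := by
  rcases h with _ | _ | h
  · simp [catMeanders, catStep, Finset.card_image_of_injective _ List.cons_injective]
  · simp only [catMeanders, catStep]
    rw [Finset.card_union_of_disjoint (disjoint_image_cons (by norm_num) _ _)]
    simp [Finset.card_image_of_injective _ List.cons_injective]
  · simp only [catMeanders, catStep]
    rw [Finset.card_union_of_disjoint, Finset.card_union_of_disjoint]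
    · simp [Finset.card_image_of_injective _ List.cons_injective]
    · exact disjoint_image_cons (by norm_num) _ _
    · rw [Finset.disjoint_union_left]
      exact ⟨disjoint_image_cons (by omega) _ _, disjoint_image_cons (by omega) _ _⟩

/-! ### Words over a letter `false` of weight `1` and a letter `true` of weight `3` -/

/-- The weight of a word: `1` for each `false` and `3` for each `true`. -/
def wordWeight : List Bool → ℕ
  | [] => 0
  | false :: w => wordWeight w + 1
  | true :: w => wordWeight w + 3

/-- The height reached from `k` reading the word from right to left,
`false` going up and `true` going down. -/
def wordHeight (k : ℤ) : List Bool → ℤ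
  | [] => k
  | false :: w => wordHeight k w + 1
  | true :: w => wordHeight k w - 1

/-- Reading the word from right to left from height `k`, every `true` ends at height at least
`1`. -/
def WordValid (k : ℤ) : List Bool → Prop
  | [] => True
  | false :: w => WordValid k w
  | true :: w => 2 ≤ wordHeight k w ∧ WordValid k w

theorem wordWeight_append (w v : List Bool) :
    wordWeight (w ++ v) = wordWeight w + wordWeight v := by
  induction w with
  | nil => simp [wordWeight]
  | cons b w ih => cases b <;> simp [wordWeight, ih] <;> omega

theorem wordHeight_append (k : ℤ) (w v : List Bool) :
    wordHeight k (w ++ v) = wordHeight (wordHeight k v) w := by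
  induction w with
  | nil => rfl
  | cons b w ih => cases b <;> simp [wordHeight, ih]

theorem wordValid_append {k : ℤ} {w v : List Bool} :
    WordValid k (w ++ v) ↔ WordValid (wordHeight k v) w ∧ WordValid k v := by
  induction w with
  | nil => simp [WordValid]
  | cons b w ih => cases b <;> simp [WordValid, ih, wordHeight_append, and_assoc]

theorem wordHeight_parity (w : List Bool) :
    (wordHeight 0 w - (wordWeight w : ℤ)) % 2 = 0 := by
  induction w with
  | nil => rfl
  | cons b w ih => cases b <;> simp only [wordHeight, wordWeight] <;> push_cast <;> omega

theorem WordValid.wordHeight_nonneg {w : List Bool} (h : WordValid 0 w) : 0 ≤ wordHeight 0 w := by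
  induction w with
  | nil => simp [wordHeight]
  | cons b w ih =>
    cases b
    · have := ih h
      simp only [wordHeight]; omega
    · have := h.1
      simp only [wordHeight]; omega

/-- The words of weight `m` that are valid from height `j + 1`. -/
def validWords : ℕ → ℕ → Finset (List Bool)
  | 0, _ => {[]}
  | 1, j => (validWords 0 (j + 1)).image (· ++ [false])
  | 2, j => (validWords 1 (j + 1)).image (· ++ [false])
  | m + 3, 0 => (validWords (m + 2) 1).image (· ++ [false])
  | m + 3, j + 1 => (validWords (m + 2) (j + 2)).image (· ++ [false]) ∪
      (validWords m j).image (· ++ [true])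

theorem concat_mem_image_concat {s : Finset (List Bool)} {w : List Bool} {b c : Bool} :
    w ++ [b] ∈ s.image (· ++ [c]) ↔ b = c ∧ w ∈ s := by
  simp only [Finset.mem_image]
  constructor
  · rintro ⟨x, hx, h⟩
    obtain ⟨rfl, hc⟩ := List.append_inj' h rfl
    exact ⟨(List.cons.inj hc).1.symm, hx⟩
  · rintro ⟨rfl, hw⟩
    exact ⟨w, hw, rfl⟩

theorem mem_validWords (m j : ℕ) (w : List Bool) :
    w ∈ validWords m j ↔ wordWeight w = m ∧ WordValid (j + 1) w := by
  induction m, j using validWords.induct generalizing w <;>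
    rcases List.eq_nil_or_concat' w with rfl | ⟨w, _ | _, rfl⟩ <;> rw [validWords]
  all_goals
    simp only [*, concat_mem_image_concat, Finset.mem_union, wordWeight, WordValid,
      wordWeight_append, wordValid_append, wordHeight, Nat.cast_add, Nat.cast_one, Nat.cast_ofNat,
      Nat.cast_zero]
  all_goals simp
  all_goals grind

theorem card_image_concat (s : Finset (List Bool)) (b : Bool) :
    (s.image (· ++ [b])).card = s.card :=
  Finset.card_image_of_injective _ (List.append_left_injective [b])

theorem card_validWords_succ_zero (m : ℕ) :
    (validWords (m + 1) 0).card = (validWords m 1).card := by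
  rcases m with _ | _ | m <;> simp only [validWords, card_image_concat]

theorem card_validWords_add_three (m j : ℕ) :
    (validWords (m + 3) (j + 1)).card =
      (validWords (m + 2) (j + 2)).card + (validWords m j).card := by
  simp only [validWords]
  rw [Finset.card_union_of_disjoint, card_image_concat, card_image_concat]
  rw [Finset.disjoint_left]
  simp only [Finset.mem_image]
  rintro _ ⟨x, _, rfl⟩ ⟨y, _, h⟩
  simpa using congrArg List.getLast? h

/-! ### Comparison of the two counts -/

/-- The sums `∑ j ≤ h, c (h - j) * v j`, where `c i` is the number of compositions of `i` into
parts `1` and `3`. -/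
def compSum (v : ℕ → ℕ) : ℕ → ℕ
  | 0 => v 0
  | 1 => v 1 + v 0
  | 2 => v 2 + (v 1 + v 0)
  | h + 3 => v (h + 3) + compSum v (h + 2) + compSum v h

/-- The linear change of variables turning `catStep` into the transfer operator of Dyck paths. -/
def compTransform (v : ℕ → ℕ) : ℕ → ℕ
  | 0 => v 0
  | 1 => v 1
  | 2 => v 2
  | h + 3 => v (h + 3) + compSum v h

theorem compSum_catStep_succ (v : ℕ → ℕ) (h : ℕ) :
    compSum (catStep v) (h + 1) + v 0 = compSum v (h + 2) + compSum v h := by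
  induction h using Nat.strong_induction_on with
  | _ h ih =>
    rcases h with _ | _ | _ | h
    · simp [compSum, catStep]; ring
    · simp [compSum, catStep]; ring
    · simp [compSum, catStep]; ring
    · have h1 : compSum (catStep v) (h + 3) + v 0 = compSum v (h + 4) + compSum v (h + 2) :=
        ih (h + 2) (by omega)
      have h2 : compSum (catStep v) (h + 1) + v 0 = compSum v (h + 2) + compSum v h :=
        ih h (by omega)
      have e1 : compSum (catStep v) (h + 4) = (v (h + 5) + v (h + 3) + v 0) +
        compSum (catStep v) (h + 3) + compSum (catStep v) (h + 1) := rfl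
      have e2 : compSum v (h + 5) = v (h + 5) + compSum v (h + 4) + compSum v (h + 2) := rfl
      have e3 : compSum v (h + 3) = v (h + 3) + compSum v (h + 2) + compSum v h := rfl
      change compSum (catStep v) (h + 4) + v 0 = compSum v (h + 5) + compSum v (h + 3)
      omega

theorem compTransform_catStep_succ (v : ℕ → ℕ) (h : ℕ) :
    compTransform (catStep v) (h + 1) = compTransform v (h + 2) + compTransform v h := by
  rcases h with _ | _ | _ | _ | h
  · simp [compTransform, catStep]
  · simp [compTransform, catStep, compSum]; ring
  · simp [compTransform, catStep, compSum]; ring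
  · simp [compTransform, catStep, compSum]; ring
  · have : compSum (catStep v) (h + 2) + v 0 = compSum v (h + 3) + compSum v (h + 1) :=
      compSum_catStep_succ v (h + 1)
    change v (h + 6) + v (h + 4) + v 0 + compSum (catStep v) (h + 2) =
      v (h + 6) + compSum v (h + 3) + (v (h + 4) + compSum v (h + 1))
    omega

theorem card_validWords_of_le (m j : ℕ) (hj : m ≤ j) :
    (validWords m j).card = compTransform (fun _ => 1) m := by
  induction m using Nat.strong_induction_on generalizing j with
  | _ m ih =>
    rcases m with _ | _ | _ | m
    · simp [validWords, compTransform]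
    · simp [validWords, compTransform]
    · simp [validWords, compTransform]
    · obtain ⟨j, rfl⟩ : ∃ i, j = i + 1 := ⟨j - 1, by omega⟩
      rw [card_validWords_add_three, ih _ (by omega) _ (by omega), ih _ (by omega) _ (by omega)]
      rcases m with _ | _ | _ | m <;> simp [compTransform, compSum]
      omega

theorem card_validWords_eq_compTransform (n h : ℕ) :
    (validWords (2 * n + h) h).card = compTransform (fun k => (catMeanders n k).card) h := by
  induction n generalizing h with
  | zero => simpa [catMeanders] using card_validWords_of_le h h le_rfl
  | succ n ih =>
    have e : (fun k => (catMeanders (n + 1) k).card) =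
        catStep (fun k => (catMeanders n k).card) := funext (card_catMeanders_succ n)
    rw [e]
    rcases h with _ | h
    · exact (card_validWords_succ_zero (2 * n + 1)).trans (ih 1)
    · rw [compTransform_catStep_succ, ← ih, ← ih,
        show 2 * (n + 1) + (h + 1) = 2 * n + h + 3 by ring, card_validWords_add_three]
      rfl

/-! ### Occurrences of `duu` -/

/-- The word obtained by reading a path from left to right, writing `true` for each occurrence of
`duu` and `false` for each step outside these occurrences. -/
def duuWord : List ℤ → List Bool
  | [] => []
  | s :: r =>
    if (s :: r).take 3 = [-1, 1, 1] then true :: duuWord (r.drop 2) else false :: duuWord r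
termination_by l => l.length
decreasing_by all_goals simp; try omega

/-- The positions of the letters `true`, positions being measured by weight. -/
def wordPositions : List Bool → Set ℕ
  | [] => ∅
  | false :: w => Nat.succ '' wordPositions w
  | true :: w => insert 0 ((· + 3) '' wordPositions w)

theorem duuWord_duu (r : List ℤ) : duuWord (-1 :: 1 :: 1 :: r) = true :: duuWord r := by
  rw [duuWord]; simp

theorem duuWord_up (r : List ℤ) : duuWord (1 :: r) = false :: duuWord r := by
  rw [duuWord]; simp

theorem duuWord_down {r : List ℤ} (hr : r.head? ≠ some 1) :
    duuWord (-1 :: r) = false :: duuWord r := by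
  rw [duuWord, if_neg]
  cases r <;> simp_all

theorem duuSet_cons_of_not {s : ℤ} {r : List ℤ} (h : (s :: r).take 3 ≠ [-1, 1, 1]) :
    duuSet (s :: r) = Nat.succ '' duuSet r := by
  ext i
  cases i with
  | zero => simpa [duuSet] using h
  | succ i => simp [duuSet]

theorem duuSet_duu (r : List ℤ) :
    duuSet (-1 :: 1 :: 1 :: r) = insert 0 ((· + 3) '' duuSet r) := by
  ext i
  rcases i with _ | _ | _ | i <;> simp [duuSet]

theorem exists_of_take_eq {s : ℤ} {r : List ℤ} (h : (s :: r).take 3 = [-1, 1, 1]) :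
    s = -1 ∧ r = 1 :: 1 :: r.drop 2 := by
  rcases r with _ | ⟨a, _ | ⟨b, r⟩⟩ <;> simp_all

theorem duuSet_eq_wordPositions (l : List ℤ) : duuSet l = wordPositions (duuWord l) := by
  induction l using duuWord.induct with
  | case1 => simp [duuWord, wordPositions, duuSet]
  | case2 s r h ih =>
    obtain ⟨rfl, hr⟩ := exists_of_take_eq h
    rw [hr, duuWord_duu, duuSet_duu, ih, wordPositions]
  | case3 s r h ih => rw [duuWord, if_neg h, duuSet_cons_of_not h, ih, wordPositions]

theorem wordWeight_duuWord (l : List ℤ) : wordWeight (duuWord l) = l.length := by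
  induction l using duuWord.induct with
  | case1 => simp [duuWord, wordWeight]
  | case2 s r h ih =>
    obtain ⟨rfl, hr⟩ := exists_of_take_eq h
    rw [hr, duuWord_duu, wordWeight, ih]
    simp
  | case3 s r h ih => rw [duuWord, if_neg h, wordWeight, ih, List.length_cons]

theorem wordPositions_injective {w v : List Bool} (hwt : wordWeight w = wordWeight v)
    (h : wordPositions w = wordPositions v) : w = v := by
  induction w generalizing v with
  | nil => rcases v with _ | ⟨_ | _, v⟩ <;> simp_all [wordWeight]
  | cons b w ih =>
    have key := Set.ext_iff.1 h 0
    rcases v with _ | ⟨c, v⟩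
    · cases b <;> simp [wordWeight] at hwt
    · cases b <;> cases c
      · rw [ih (by simpa [wordWeight] using hwt) (Nat.succ_injective.image_injective h)]
      · simp [wordPositions] at key
      · simp [wordPositions] at key
      · rw [ih (by simpa [wordWeight] using hwt)]
        have := congrArg (fun s => (· + 3) ⁻¹' s) h
        ext i
        simpa [wordPositions] using Set.ext_iff.1 this i

/-- `l` is a path with steps `±1` from altitude `h` to altitude `0` whose altitudes after each
step are nonnegative. -/
def DyckPathFrom : ℤ → List ℤ → Prop
  | h, [] => h = 0
  | h, s :: r => (s = 1 ∨ s = -1) ∧ 0 ≤ h + s ∧ DyckPathFrom (h + s) r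

theorem dyckPathFrom_iff {h : ℤ} (hh : 0 ≤ h) (l : List ℤ) :
    DyckPathFrom h l ↔ (∀ s ∈ l, s = 1 ∨ s = -1) ∧ (∀ i : ℕ, 0 ≤ h + (l.take i).sum) ∧
      h + l.sum = 0 := by
  induction l generalizing h with
  | nil => simp [DyckPathFrom, hh]
  | cons s r ih =>
    simp only [DyckPathFrom, List.mem_cons, forall_eq_or_imp, List.sum_cons, ← add_assoc]
    constructor
    · rintro ⟨hs, h0, hp⟩
      obtain ⟨h1, h2, h3⟩ := (ih h0).1 hp
      refine ⟨⟨hs, h1⟩, fun i => ?_, h3⟩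
      cases i with
      | zero => simpa using hh
      | succ i => simpa [← add_assoc] using h2 i
    · rintro ⟨⟨hs, h1⟩, h2, h3⟩
      have h0 : 0 ≤ h + s := by simpa using h2 1
      exact ⟨hs, h0, (ih h0).2 ⟨h1, fun i => by simpa [← add_assoc] using h2 (i + 1), h3⟩⟩

theorem isDyckExc_iff (l : List ℤ) : IsDyckExc l ↔ DyckPathFrom 0 l := by
  simp [dyckPathFrom_iff, IsDyckExc]

theorem DyckPathFrom.wordValid_duuWord {h : ℤ} {l : List ℤ} (hh : 0 ≤ h)
    (hl : DyckPathFrom h l) : WordValid 0 (duuWord l) ∧ h ≤ wordHeight 0 (duuWord l) := by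
  induction l using duuWord.induct generalizing h with
  | case1 => simpa [duuWord, WordValid, wordHeight, DyckPathFrom] using hl.le
  | case2 s r hd ih =>
    obtain ⟨rfl, hr⟩ := exists_of_take_eq hd
    rw [hr] at hl ⊢
    obtain ⟨_, h1, _, h2, _, h3, hp⟩ := hl
    obtain ⟨hv, hle⟩ := ih h3 hp
    rw [duuWord_duu]
    exact ⟨⟨by omega, hv⟩, by rw [wordHeight]; omega⟩
  | case3 s r hd ih =>
    obtain ⟨hs, h1, hp⟩ := hl
    obtain ⟨hv, hle⟩ := ih h1 hp
    rw [duuWord, if_neg hd]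
    exact ⟨hv, by rw [wordHeight]; omega⟩

theorem DyckPathFrom.head?_duuWord {l : List ℤ} (hl : DyckPathFrom 0 l) :
    (duuWord l).head? ≠ some true := by
  rcases l with _ | ⟨s, r⟩
  · simp [duuWord]
  · have h0 := hl.2.1
    rw [duuWord, if_neg]
    · simp
    · intro h
      have := (exists_of_take_eq h).1
      omega

theorem exists_highest_dyckPathFrom {w : List Bool} (hw : WordValid 0 w) :
    ∃ l, DyckPathFrom (wordHeight 0 w) l ∧ duuWord l = w ∧ l.head? ≠ some 1 := by
  induction w with
  | nil => exact ⟨[], rfl, by simp [duuWord], by simp⟩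
  | cons b w ih =>
    cases b
    · obtain ⟨l, hp, hd, hh⟩ := ih hw
      have := WordValid.wordHeight_nonneg (w := w) hw
      refine ⟨-1 :: l, ⟨Or.inr rfl, by rw [wordHeight]; omega, ?_⟩, by rw [duuWord_down hh, hd],
        by simp⟩
      simpa [wordHeight] using hp
    · obtain ⟨h2, hw⟩ := hw
      obtain ⟨l, hp, hd, hh⟩ := ih hw
      refine ⟨-1 :: 1 :: 1 :: l, ⟨Or.inr rfl, ?_, Or.inl rfl, ?_, Or.inl rfl, ?_, ?_⟩,
        by rw [duuWord_duu, hd], by simp⟩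
      · rw [wordHeight]; omega
      · rw [wordHeight]; omega
      · rw [wordHeight]; omega
      · simpa [wordHeight] using hp

theorem exists_dyckPathFrom {w : List Bool} {h : ℤ} (hw : WordValid 0 w) (h0 : 0 ≤ h)
    (hle : h ≤ wordHeight 0 w) (hpar : (wordHeight 0 w - h) % 2 = 0)
    (hhead : 1 ≤ h ∨ w.head? ≠ some true) : ∃ l, DyckPathFrom h l ∧ duuWord l = w := by
  induction w generalizing h with
  | nil =>
    have : h = 0 := le_antisymm hle h0
    exact ⟨[], this, by simp [duuWord]⟩
  | cons b w ih =>
    cases b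
    · by_cases heq : h = wordHeight 0 (false :: w)
      · obtain ⟨l, hp, hd, _⟩ := exists_highest_dyckPathFrom hw
        exact ⟨l, heq ▸ hp, hd⟩
      · simp only [wordHeight] at hle hpar heq
        obtain ⟨l, hp, hd⟩ := ih (h := h + 1) hw (by omega) (by omega) (by omega)
          (Or.inl (by omega))
        exact ⟨1 :: l, ⟨Or.inl rfl, by omega, hp⟩, by rw [duuWord_up, hd]⟩
    · have h1 : 1 ≤ h := by simpa using hhead
      simp only [wordHeight] at hle hpar
      obtain ⟨l, hp, hd⟩ := ih (h := h + 1) hw.2 (by omega) (by omega) (by omega)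
        (Or.inl (by omega))
      refine ⟨-1 :: 1 :: 1 :: l, ⟨Or.inr rfl, by omega, Or.inl rfl, by omega, Or.inl rfl,
        by omega, ?_⟩, by rw [duuWord_duu, hd]⟩
      rwa [show h + -1 + 1 + 1 = h + 1 by ring]

theorem exists_isDyckExc_iff (n : ℕ) (w : List Bool) :
    (∃ l : List ℤ, l.length = 2 * n + 2 ∧ IsDyckExc l ∧ duuWord l = w) ↔
      ∃ x ∈ validWords (2 * n) 0, false :: (x ++ [false]) = w := by
  simp only [mem_validWords, isDyckExc_iff]
  constructor
  · rintro ⟨l, hl, hp, rfl⟩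
    have hwt := wordWeight_duuWord l
    have hhead := hp.head?_duuWord
    have hv := (hp.wordValid_duuWord le_rfl).1
    rw [hl] at hwt
    generalize duuWord l = w at *
    rcases w with _ | ⟨_ | _, w⟩
    · simp [wordWeight] at hwt
    · rcases List.eq_nil_or_concat' w with rfl | ⟨x, b, rfl⟩
      · simp [wordWeight] at hwt
      · simp only [WordValid, wordValid_append] at hv
        cases b
        · simp only [wordWeight, wordWeight_append] at hwt
          exact ⟨x, ⟨by omega, by simpa [wordHeight] using hv.1⟩, rfl⟩
        · simp [WordValid, wordHeight] at hv
    · simp at hhead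
  · rintro ⟨x, ⟨hwt, hv⟩, rfl⟩
    have hv' : WordValid 0 (false :: (x ++ [false])) := by
      simpa [WordValid, wordValid_append, wordHeight] using hv
    have hwt' : wordWeight (false :: (x ++ [false])) = 2 * n + 2 := by
      simp [wordWeight, wordWeight_append, hwt]
    have hpar := wordHeight_parity (false :: (x ++ [false]))
    rw [hwt'] at hpar
    push_cast at hpar
    obtain ⟨l, hp, hd⟩ := exists_dyckPathFrom hv' le_rfl hv'.wordHeight_nonneg (by omega)
      (Or.inr (by simp))
    exact ⟨l, by rw [← wordWeight_duuWord, hd, hwt'], hp, hd⟩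

/-- **Equivalence classes for the pattern `duu`.** Two classical Dyck
excursions of the same length are equivalent iff their `duu`-patterns occur at
exactly the same positions. The number of equivalence classes of classical
Dyck excursions of length `2n + 2` equals `m n`, the number of Dyck meanders
with catastrophes of length `n`. -/
theorem duu_classes_eq_mCount (n : ℕ) :
    Nat.card {S : Set ℕ //
        ∃ l : List ℤ, l.length = 2 * n + 2 ∧ IsDyckExc l ∧ duuSet l = S} =
      mCount n := by
  have himage : {S : Set ℕ | ∃ l : List ℤ, l.length = 2 * n + 2 ∧ IsDyckExc l ∧ duuSet l = S} =
      (fun x => wordPositions (false :: (x ++ [false]))) ''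
        (validWords (2 * n) 0 : Set (List Bool)) := by
    ext S
    simp only [Set.mem_ofPred_eq, Set.mem_image, Finset.mem_coe]
    constructor
    · rintro ⟨l, hl, hp, rfl⟩
      obtain ⟨x, hx, hw⟩ := (exists_isDyckExc_iff n _).1 ⟨l, hl, hp, rfl⟩
      exact ⟨x, hx, by rw [hw, duuSet_eq_wordPositions]⟩
    · rintro ⟨x, hx, rfl⟩
      obtain ⟨l, hl, hp, hd⟩ := (exists_isDyckExc_iff n _).2 ⟨x, hx, rfl⟩
      exact ⟨l, hl, hp, by rw [duuSet_eq_wordPositions, hd]⟩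
  have hinj : Set.InjOn (fun x => wordPositions (false :: (x ++ [false])))
      (validWords (2 * n) 0 : Set (List Bool)) := by
    intro x hx y hy h
    rw [Finset.mem_coe, mem_validWords] at hx hy
    have := wordPositions_injective (by simp [wordWeight, wordWeight_append, hx.1, hy.1]) h
    simpa using this
  calc _ = Set.ncard {S : Set ℕ |
        ∃ l : List ℤ, l.length = 2 * n + 2 ∧ IsDyckExc l ∧ duuSet l = S} := rfl
    _ = (validWords (2 * n) 0).card := by
      rw [himage, hinj.ncard_image, Set.ncard_coe_finset]
    _ = mCount n := by
      rw [mCount_eq_card_catMeanders]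
      exact card_validWords_eq_compTransform n 0
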